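/- arXiv:1803.01057 — 3 statements merged into one kernel-verified Lean document; each statement's English description precedes it below -/
import Mathlib

section
/- Let H be a complex Hilbert space, let R = {(P,f) : P an orthogonal projection on H, Pf = f, ‖f‖ = 1} be endowed with the topology inherited from B(H) × H (operator norm on B(H), norm on H), and let (P0,f0) ∈ R. Then the connected component of (P0,f0) in R equals R_{P0} = {(P,f) ∈ R : P is unitarily equivalent to P0}. -/
/-- The canonical sphere bundle `R = {(P, f) : P an orthogonal projection, P f = f, ‖f‖ = 1}`,
as a subset of `B(H) × H`. -/
def sphereBundle (H : Type*) [NormedAddCommGroup H] [InnerProductSpace ℂ H]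
    [CompleteSpace H] : Set ((H →L[ℂ] H) × H) :=
  {Pf | IsSelfAdjoint Pf.1 ∧ Pf.1 * Pf.1 = Pf.1 ∧ Pf.1 Pf.2 = Pf.2 ∧ ‖Pf.2‖ = 1}

theorem aux_sign {H : Type*} [NormedAddCommGroup H] [InnerProductSpace ℂ H] [CompleteSpace H]
    (B : H →L[ℂ] H) (hB : IsSelfAdjoint B) : ∃ S : H →L[ℂ] H, IsSelfAdjoint S ∧ S * S = 1 ∧
      0 ≤ S * B ∧ ∀ U : H →L[ℂ] H, Commute B U → Commute B (star U) → Commute S U := by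
  set N := B⁻ with hN
  set K : Submodule ℂ H := LinearMap.ker (N : H →ₗ[ℂ] H) with hK
  have hKc : IsClosed (K : Set H) := N.isClosed_ker
  have : CompleteSpace K := hKc.completeSpace_coe
  set E := K.starProjection with hE
  have hEs : IsSelfAdjoint E := isSelfAdjoint_starProjection K
  have hEE : E * E = E := K.isIdempotentElem_starProjection
  have hNs : IsSelfAdjoint N := (CFC.negPart_nonneg B).isSelfAdjoint
  have key : ∀ X : H →L[ℂ] H, (∀ x, N (X x) = 0) → E * X = X := by
    intro X hX
    ext x
    exact Submodule.starProjection_eq_self_iff.2 (hX x)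
  have hNE : N * E = 0 := by
    ext x
    exact K.starProjection_apply_mem x
  have hEN : E * N = 0 := by
    have := congrArg star hNE
    simpa [hEs.star_eq, hNs.star_eq] using this
  have hEP : E * B⁺ = B⁺ := by
    apply key
    intro x
    exact DFunLike.congr_fun (CFC.negPart_mul_posPart B) x
  have hinv : ∀ U : H →L[ℂ] H, Commute B U → E * (U * E) = U * E := by
    intro U hU
    apply key
    intro x
    have h1 : Commute N U := by
      rw [hN, CFC.negPart_def]
      exact hU.cfcₙ_real _
    have : N * (U * E) = 0 := by rw [← mul_assoc, h1.eq, mul_assoc, hNE, mul_zero]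
    exact DFunLike.congr_fun this x
  refine ⟨2 * E - 1, ?_, ?_, ?_, ?_⟩
  · simp [IsSelfAdjoint, hEs.star_eq, two_mul]
  · have : (2 * E - 1) * (2 * E - 1) = 4 * (E * E) - 4 * E + 1 := by noncomm_ring
    rw [this, hEE]; simp
  · have : (2 * E - 1) * B = B⁺ + B⁻ := by
      conv_lhs => rw [← CFC.posPart_sub_negPart B hB]
      have : (2 * E - 1) * (B⁺ - B⁻) = 2 * (E * B⁺) - B⁺ - 2 * (E * B⁻) + B⁻ := by noncomm_ring
      rw [this, hEP, hEN]; noncomm_ring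
    rw [this]
    exact add_nonneg (CFC.posPart_nonneg B) (CFC.negPart_nonneg B)
  · intro U h1 h2
    have a := hinv U h1
    have b := congrArg star (hinv _ h2)
    simp only [star_mul, star_star, hEs.star_eq] at b
    have : E * U = U * E := by rw [← a, ← mul_assoc, b]
    have h : Commute E U := this
    exact ((Commute.ofNat_left 2 U).mul_left h).sub_left (Commute.one_left U)

theorem aux_joined {H : Type*} [NormedAddCommGroup H] [InnerProductSpace ℂ H] [CompleteSpace H]
    (U : unitary (H →L[ℂ] H)) : Joined (1 : unitary (H →L[ℂ] H)) U := by
  obtain ⟨u, hu⟩ := U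
  have hu1 : star u * u = 1 := (Unitary.mem_iff.1 hu).1
  have hu2 : u * star u = 1 := (Unitary.mem_iff.1 hu).2
  have hc : Commute u (star u) := by rw [Commute, SemiconjBy, hu1, hu2]
  obtain ⟨S, hS, hSS, hpos, hcomm⟩ := aux_sign (Complex.I • (star u - u)) (by
    simp [IsSelfAdjoint, star_smul, ← smul_neg])
  have hSu : Commute S u := hcomm u ((hc.symm.sub_left (Commute.refl u)).smul_left _)
    (((Commute.refl (star u)).sub_left hc).smul_left _)
  have hV : Complex.I • S ∈ unitary (H →L[ℂ] H) := by
    rw [Unitary.mem_iff]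
    simp [star_smul, hS.star_eq, hSS, smul_smul]
  have bound : ∀ x : H →L[ℂ] H, star x * x ≤ 2 → ‖x‖ < 2 := by
    intro x hx
    have h := CStarAlgebra.norm_le_norm_of_nonneg_of_le (star_mul_self_nonneg x) hx
    rw [CStarRing.norm_star_mul_self] at h
    have h2 : ‖(2 : H →L[ℂ] H)‖ ≤ 2 := by
      rw [← one_add_one_eq_two]
      refine (norm_add_le _ _).trans ?_
      have := ContinuousLinearMap.norm_id_le (𝕜 := ℂ) (E := H)
      have h3 : ‖(1 : H →L[ℂ] H)‖ ≤ 1 := this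
      linarith
    nlinarith [norm_nonneg x]
  refine (Unitary.joined 1 ⟨_, hV⟩ (bound _ ?_)).trans (Unitary.joined ⟨_, hV⟩ ⟨u, hu⟩ (bound _ ?_))
  · have : star (Complex.I • S - 1) * (Complex.I • S - 1) = 2 := by
      simp [star_smul, hS.star_eq, sub_mul, mul_sub, hSS, smul_sub, smul_smul, ← one_add_one_eq_two]
      abel
    exact this.le
  · have h1 : star (u - Complex.I • S) * (u - Complex.I • S) = 2 - S * (Complex.I • (star u - u)) := by
      have h3 : star u * S = S * star u := by
        have := congrArg star hSu.eq
        simpa [hS.star_eq] using this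
      simp only [star_sub, star_smul, hS.star_eq, sub_mul, mul_sub, hSS, smul_smul, hu1,
        smul_mul_assoc, mul_smul_comm, h3, smul_sub]
      simp [← one_add_one_eq_two]
      abel
    have : star (u - Complex.I • S) * (u - Complex.I • S) ≤ 2 := by
      rw [h1]; exact sub_le_self _ hpos
    exact this

theorem aux_near {H : Type*} [NormedAddCommGroup H] [InnerProductSpace ℂ H] [CompleteSpace H]
    (P Q : H →L[ℂ] H) (hP : IsSelfAdjoint P) (hPP : P * P = P) (hQ : IsSelfAdjoint Q)
    (hQQ : Q * Q = Q) (h : ‖Q - P‖ < 1) :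
    ∃ U ∈ unitary (H →L[ℂ] H), U * P * star U = Q := by
  set T : H →L[ℂ] H := Q * P + (1 - Q) * (1 - P) with hT
  have hTs : star T = P * Q + (1 - P) * (1 - Q) := by
    simp [hT, hP.star_eq, hQ.star_eq]
  have hTP : T * P = Q * T := by
    have h1 : T * P = Q * (P * P) + (1 - Q) * (P - P * P) := by rw [hT]; noncomm_ring
    have h2 : Q * T = (Q * Q) * P + (Q - Q * Q) * (1 - P) := by rw [hT]; noncomm_ring
    rw [h1, h2, hPP, hQQ]; simp
  have hPT : star T * Q = P * star T := by
    have := congrArg star hTP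
    simpa [hP.star_eq, hQ.star_eq] using this.symm
  have e1 : star T * T = 1 - (Q - P) * (Q - P) := by
    rw [hTs, hT]
    have : (P * Q + (1 - P) * (1 - Q)) * (Q * P + (1 - Q) * (1 - P)) =
      P * (Q * Q) * P + P * (Q - Q * Q) * (1 - P) + (1 - P) * (Q - Q * Q) * P
       + (1 - P) * (1 - Q - (Q - Q * Q)) * (1 - P) := by noncomm_ring
    rw [this, hQQ]
    have : (Q - P) * (Q - P) = Q * Q - Q * P - P * Q + P * P := by noncomm_ring
    rw [this, hQQ, hPP]
    have : P * Q * P + P * (Q - Q) * (1 - P) + (1 - P) * (Q - Q) * P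
       + (1 - P) * (1 - Q - (Q - Q)) * (1 - P) = 1 - P - P + P * P - Q + Q * P + P * Q := by
         noncomm_ring
    rw [this, hPP]; noncomm_ring
  have e2 : T * star T = 1 - (Q - P) * (Q - P) := by
    rw [hTs, hT]
    have : (Q * P + (1 - Q) * (1 - P)) * (P * Q + (1 - P) * (1 - Q)) =
      Q * (P * P) * Q + Q * (P - P * P) * (1 - Q) + (1 - Q) * (P - P * P) * Q
       + (1 - Q) * (1 - P - (P - P * P)) * (1 - Q) := by noncomm_ring
    rw [this, hPP]
    have : (Q - P) * (Q - P) = Q * Q - Q * P - P * Q + P * P := by noncomm_ring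
    rw [this, hQQ, hPP]
    have : Q * P * Q + Q * (P - P) * (1 - Q) + (1 - Q) * (P - P) * Q
       + (1 - Q) * (1 - P - (P - P)) * (1 - Q) = 1 - Q - Q + Q * Q - P + P * Q + Q * P := by
         noncomm_ring
    rw [this, hQQ]; noncomm_ring
  have hu : IsUnit (star T * T) := by
    rw [e1]
    apply isUnit_one_sub_of_norm_lt_one
    refine (norm_mul_le _ _).trans_lt ?_
    nlinarith [norm_nonneg (Q - P)]
  set a := star T * T with ha
  have hTa : Commute T a := by
    rw [Commute, SemiconjBy, ha, ← mul_assoc, e2, ← e1]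
  have hPa : Commute P a := by
    rw [Commute, SemiconjBy, ha, ← mul_assoc, ← hPT, mul_assoc, mul_assoc, hTP]
  have hpos : IsStrictlyPositive a := by
    exact ⟨star_mul_self_nonneg T, hu⟩
  set b := a ^ (-(1/2) : ℝ) with hb
  have hbs : IsSelfAdjoint b := (CFC.rpow_nonneg (a := a)).isSelfAdjoint
  have hbc : ∀ X, Commute X a → Commute b X := by
    intro X hX
    rw [hb, CFC.rpow_def]
    exact hX.symm.cfc_nnreal _
  have hbb : b * b * a = 1 := by
    rw [hb, ← CFC.rpow_add hu]
    have := CFC.rpow_neg_mul_rpow 1 hpos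
    rw [CFC.rpow_one a hpos.nonneg] at this
    norm_num
    exact this
  have hba := (hbc a (Commute.refl a)).eq
  have hbT := (hbc T hTa).eq
  have hbP := (hbc P hPa).eq
  have h1 : T * b * star (T * b) = 1 := by
    rw [star_mul, hbs.star_eq, ← hbT]
    calc b * T * (b * star T) = b * (T * b) * star T := by noncomm_ring
      _ = b * b * (T * star T) := by rw [← hbT]; noncomm_ring
      _ = 1 := by rw [e2, ← e1, hbb]
  refine ⟨T * b, ?_, ?_⟩
  · rw [Unitary.mem_iff]
    refine ⟨?_, h1⟩
    rw [star_mul, hbs.star_eq]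
    calc b * star T * (T * b) = b * (a * b) := by rw [ha]; noncomm_ring
      _ = 1 := by rw [← hba, ← mul_assoc, hbb]
  · calc T * b * P * star (T * b) = T * (b * P) * star (T * b) := by noncomm_ring
      _ = (T * P) * b * star (T * b) := by rw [hbP]; noncomm_ring
      _ = Q * (T * b * star (T * b)) := by rw [hTP]; noncomm_ring
      _ = Q := by rw [h1, mul_one]

theorem aux_sphere {H : Type*} [NormedAddCommGroup H] [InnerProductSpace ℂ H] [CompleteSpace H]
    (P : H →L[ℂ] H) : IsPreconnected {f : H | P f = f ∧ ‖f‖ = 1} := by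
  set K : Submodule ℂ H := LinearMap.ker ((P - 1 : H →L[ℂ] H) : H →ₗ[ℂ] H) with hK
  have hmem : ∀ x, x ∈ K ↔ P x = x := by
    intro x
    simp [hK, sub_eq_zero]
  have himg : {f : H | P f = f ∧ ‖f‖ = 1} = Set.image (fun x : K => (x : H)) (Metric.sphere (0 : K) 1) := by
    ext f
    constructor
    · rintro ⟨h1, h2⟩
      exact ⟨⟨f, (hmem f).2 h1⟩, by simpa using h2, rfl⟩
    · rintro ⟨x, hx, rfl⟩
      exact ⟨(hmem _).1 x.2, by simpa using hx⟩
  rw [himg]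
  refine IsPreconnected.image ?_ _ continuous_subtype_val.continuousOn
  rcases subsingleton_or_nontrivial K with h | h
  · exact (Set.subsingleton_of_subsingleton).isPreconnected
  · apply isPreconnected_sphere
    rw [rank_real_of_complex]
    have h1 : (1 : Cardinal) ≤ Module.rank ℂ K := Cardinal.one_le_iff_pos.2 rank_pos
    calc (1 : Cardinal) < 2 * 1 := by norm_num
      _ ≤ _ := by gcongr

theorem connectedComponentIn_sphereBundle
    {H : Type*} [NormedAddCommGroup H] [InnerProductSpace ℂ H] [CompleteSpace H]
    (P0 : H →L[ℂ] H) (f0 : H) (h0 : (P0, f0) ∈ sphereBundle H) :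
    connectedComponentIn (sphereBundle H) (P0, f0) =
      {Pf | Pf ∈ sphereBundle H ∧ ∃ U ∈ unitary (H →L[ℂ] H), U * P0 * star U = Pf.1} := by
  apply Set.Subset.antisymm
  · intro p hp
    have hsub := connectedComponentIn_subset (sphereBundle H) (P0, f0)
    refine ⟨hsub hp, ?_⟩
    refine IsPreconnected.induction₂ (isPreconnected_connectedComponentIn
      (F := sphereBundle H) (x := (P0, f0)))
      (fun x y => ∃ U ∈ unitary (H →L[ℂ] H), U * x.1 * star U = y.1) ?_ ?_ ?_
      (mem_connectedComponentIn h0) hp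
    · intro x hx
      have hball : {y : (H →L[ℂ] H) × H | ‖y.1 - x.1‖ < 1} ∈ nhds x := by
        apply IsOpen.mem_nhds
        · exact isOpen_lt (by fun_prop) continuous_const
        · simp
      filter_upwards [nhdsWithin_le_nhds hball, self_mem_nhdsWithin] with y hy hys
      obtain ⟨a1, a2, -, -⟩ := hsub hx
      obtain ⟨b1, b2, -, -⟩ := hsub hys
      exact aux_near _ _ a1 a2 b1 b2 hy
    · rintro x y z - - - ⟨U, hU, h1⟩ ⟨V, hV, h2⟩
      refine ⟨V * U, mul_mem hV hU, ?_⟩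
      rw [← h2, ← h1, star_mul]
      simp only [mul_assoc]
    · rintro x y - - ⟨U, hU, h1⟩
      refine ⟨star U, Unitary.star_mem hU, ?_⟩
      have hu1 : star U * U = 1 := (Unitary.mem_iff.1 hU).1
      rw [← h1, star_star]
      calc star U * (U * x.1 * star U) * U = (star U * U) * x.1 * (star U * U) := by
            simp only [mul_assoc]
        _ = x.1 := by rw [hu1, one_mul, mul_one]
  · rintro ⟨P, f⟩ ⟨hP, U, hU, hUP⟩
    obtain ⟨a1, a2, a3, a4⟩ := h0
    simp only at a1 a2 a3 a4 hUP
    have hcon : PreconnectedSpace (unitary (H →L[ℂ] H)) := by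
      have : PathConnectedSpace (unitary (H →L[ℂ] H)) :=
        ⟨⟨1⟩, fun x y => (aux_joined x).symm.trans (aux_joined y)⟩
      infer_instance
    set F : unitary (H →L[ℂ] H) → (H →L[ℂ] H) × H :=
      fun u => ((u : H →L[ℂ] H) * P0 * star (u : H →L[ℂ] H), (u : H →L[ℂ] H) f0) with hF
    have hFc : Continuous F := by
      have hc : Continuous (fun u : unitary (H →L[ℂ] H) => (u : H →L[ℂ] H)) :=
        continuous_subtype_val
      exact ((hc.mul continuous_const).mul hc.star).prodMk (hc.clm_apply continuous_const)
    have hFR : ∀ u, F u ∈ sphereBundle H := by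
      rintro ⟨u, hu⟩
      have hu1 : star u * u = 1 := (Unitary.mem_iff.1 hu).1
      refine ⟨?_, ?_, ?_, ?_⟩
      · simp [hF, IsSelfAdjoint, a1.star_eq, mul_assoc]
      · change u * P0 * star u * (u * P0 * star u) = u * P0 * star u
        calc u * P0 * star u * (u * P0 * star u) = u * P0 * (star u * u) * (P0 * star u) := by
              simp only [mul_assoc]
          _ = u * (P0 * P0) * star u := by rw [hu1, mul_one]; simp only [mul_assoc]
          _ = _ := by rw [a2]
      · have h2 : (star u) (u f0) = f0 := DFunLike.congr_fun hu1 f0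
        change u (P0 (star u (u f0))) = u f0
        rw [h2, a3]
      · change ‖u f0‖ = 1
        rw [← a4]
        exact ContinuousLinearMap.norm_map_of_mem_unitary hu f0
    have hA : IsPreconnected (Set.range F) := isPreconnected_range hFc
    have hB : IsPreconnected (Set.image (fun g : H => (P, g)) {g : H | P g = g ∧ ‖g‖ = 1}) :=
      (aux_sphere P).image _ (by fun_prop)
    have hFU : F ⟨U, hU⟩ = (P, U f0) := by simp [hF, hUP]
    have hUf : P (U f0) = U f0 ∧ ‖U f0‖ = 1 := by
      have := hFR ⟨U, hU⟩
      rw [hFU] at this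
      exact this.2.2
    have hAB := IsPreconnected.union (P, U f0)
      (show (P, U f0) ∈ Set.range F from ⟨⟨U, hU⟩, hFU⟩)
      (show (P, U f0) ∈ Set.image (fun g : H => (P, g)) {g : H | P g = g ∧ ‖g‖ = 1} from
        ⟨U f0, hUf, rfl⟩) hA hB
    refine hAB.subset_connectedComponentIn ?_ ?_ (Or.inr ⟨f, hP.2.2, rfl⟩)
    · exact Or.inl ⟨1, by simp [hF]⟩
    · rintro x (⟨u, rfl⟩ | ⟨g, hg, rfl⟩)
      · exact hFR u
      · exact ⟨hP.1, hP.2.1, hg⟩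
end

section
/- Let H be a complex Hilbert space, P0 an orthogonal projection, f0 a unit vector with P0 f0 = f0, Q0 = P0 − f0⊗f0, and X ∈ B(H) anti-Hermitian. Suppose Y0 is anti-Hermitian with Y0 = Q0 Y0 Q0 and ‖P0(X+Y0)‖ ≤ ‖P0(X+Y)‖ for all anti-Hermitian Y with Y = Q0 Y Q0, and suppose Z0 is anti-Hermitian with Z0 = (1−P0) Z0 (1−P0) and ‖X+Y0+Z0‖ ≤ ‖X+Y0+Z‖ for all anti-Hermitian Z with Z = (1−P0) Z (1−P0). Then X0 = X + Y0 + Z0 is a minimal lifting: ‖X0‖ ≤ ‖X + W‖ for every anti-Hermitian W with W P0 = P0 W and W f0 = 0. Conversely, if X1 = X + Y1 + Z1 is any minimal lifting, with Y1 = Q0 Y1 Q0 and Z1 = (1−P0) Z1 (1−P0) anti-Hermitian, then Y1 minimizes ‖P0(X+Y)‖ over all such Y, and Z1 minimizes ‖X+Y1+Z‖ over all such Z. -/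
open scoped InnerProductSpace
open ContinuousLinearMap

/-- The rank-one operator `x ⊗ y`, with `(x ⊗ y) z = ⟨z, y⟩ x` (inner product linear in
the first variable); in Mathlib's convention this is `z ↦ ⟪y, z⟫ • x`. -/
noncomputable def rankOne {H : Type*} [NormedAddCommGroup H] [InnerProductSpace ℂ H]
    (x y : H) : H →L[ℂ] H :=
  (innerSL ℂ y).smulRight x

theorem aux_sq_le {x y : ℝ} (h : x ^ 2 ≤ y ^ 2) (hy : 0 ≤ y) : x ≤ y :=
  (le_abs_self x).trans (abs_le_of_sq_le_sq h hy)

/-- Douglas factorization. -/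
theorem aux_douglas {H : Type*} [NormedAddCommGroup H] [InnerProductSpace ℂ H] [CompleteSpace H]
    (b D : H →L[ℂ] H) (h : ∀ x, ‖b x‖ ≤ ‖D x‖) :
    ∃ k : H →L[ℂ] H, ‖k‖ ≤ 1 ∧ k * D = b := by
  let K : Submodule ℂ H := (LinearMap.range (D : H →ₗ[ℂ] H)).topologicalClosure
  have hmem : ∀ x, D x ∈ K := fun x =>
    Submodule.le_topologicalClosure _ ⟨x, rfl⟩
  have hKc : IsClosed (K : Set H) := Submodule.isClosed_topologicalClosure _
  haveI : CompleteSpace K := hKc.completeSpace_coe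
  let e : H →ₗ[ℂ] K := (D : H →ₗ[ℂ] H).codRestrict K hmem
  have hd : DenseRange e := by
    intro y
    rw [closure_subtype]
    have hy : (y : H) ∈ closure (Set.range D) := by
      have := y.2
      exact this
    convert hy using 2
    ext z
    constructor
    · rintro ⟨w, ⟨x, rfl⟩, rfl⟩
      exact ⟨x, rfl⟩
    · rintro ⟨x, rfl⟩
      exact ⟨e x, ⟨x, rfl⟩, rfl⟩
  have hn : ∀ x, ‖(b : H →ₗ[ℂ] H) x‖ ≤ 1 * ‖e x‖ := by
    intro x
    rw [one_mul]
    exact h x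
  let g := (b : H →ₗ[ℂ] H).extendOfNorm e
  have hg : ‖g‖ ≤ 1 := LinearMap.opNorm_extendOfNorm_le hd zero_le_one hn
  refine ⟨g ∘L K.orthogonalProjectionOnto, ?_, ?_⟩
  · refine (ContinuousLinearMap.opNorm_comp_le _ _).trans ?_
    have := K.orthogonalProjectionOnto_norm_le
    nlinarith [norm_nonneg g, norm_nonneg K.orthogonalProjectionOnto]
  · ext x
    have h1 : K.orthogonalProjectionOnto (D x) = e x :=
      Submodule.orthogonalProjectionOnto_mem_subspace_eq_self (K := K) (e x)
    have h2 : g (e x) = b x := LinearMap.extendOfNorm_eq hd ⟨1, hn⟩ x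
    change g (K.orthogonalProjectionOnto (D x)) = b x
    rw [h1, h2]

/-- Defect operator. -/
theorem aux_defect {H : Type*} [NormedAddCommGroup H] [InnerProductSpace ℂ H] [CompleteSpace H]
    (a : H →L[ℂ] H) (ha : IsSelfAdjoint a) (hn : ‖a‖ ≤ 1) :
    ∃ D : H →L[ℂ] H, IsSelfAdjoint D ∧ D * D = 1 - a * a ∧ D * a = a * D := by
  refine ⟨cfc (fun x : ℝ => √(1 - x ^ 2)) a, cfc_predicate _ a, ?_, ?_⟩
  · have h1 : cfc (fun x : ℝ => 1 - x * x) a = 1 - a * a := by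
      rw [cfc_sub (fun _ => 1) (fun x => x * x) a, cfc_mul (fun x => x) (fun x => x) a,
        cfc_id' ℝ a, cfc_const_one ℝ a]
    rw [← cfc_mul _ _ a, ← h1]
    apply cfc_congr
    intro x hx
    have hx1 : ‖x‖ ≤ ‖a‖ := by
      rcases subsingleton_or_nontrivial H with hs | hs
      · exfalso
        have : Subsingleton (H →L[ℂ] H) := inferInstance
        simp [spectrum.of_subsingleton] at hx
      · exact spectrum.norm_le_norm_of_mem hx
    have hx2 : |x| ≤ 1 := (hx1.trans hn)
    have : 0 ≤ 1 - x ^ 2 := by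
      have := sq_abs x
      nlinarith [abs_nonneg x]
    simp only
    rw [Real.mul_self_sqrt this]
    ring
  · have := cfc_commute_cfc (fun x : ℝ => √(1 - x ^ 2)) (fun x => x) a
    rw [cfc_id' ℝ a] at this
    exact this

theorem aux_pyth {H : Type*} [NormedAddCommGroup H] [InnerProductSpace ℂ H] [CompleteSpace H]
    (P : H →L[ℂ] H) (hP : IsSelfAdjoint P) (hPi : P * P = P) (x y : H) :
    ‖P x + (1 - P) y‖ ^ 2 = ‖P x‖ ^ 2 + ‖(1 - P) y‖ ^ 2 := by
  have h : ⟪P x, (1 - P) y⟫_ℂ = 0 := by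
    have h1 : ⟪P x, (1 - P) y⟫_ℂ = ⟪x, P ((1 - P) y)⟫_ℂ := hP.isSymmetric x _
    have h2 : P ((1 - P) y) = 0 := by
      change (P * (1 - P)) y = 0
      rw [mul_sub, mul_one, hPi, sub_self]; rfl
    rw [h1, h2, inner_zero_right]
  have := norm_add_sq_eq_norm_sq_add_norm_sq_of_inner_eq_zero _ _ h
  nlinarith

theorem aux_defect_norm {H : Type*} [NormedAddCommGroup H] [InnerProductSpace ℂ H]
    [CompleteSpace H]
    (a D : H →L[ℂ] H) (ha : IsSelfAdjoint a) (hD : IsSelfAdjoint D)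
    (h : D * D = 1 - a * a) (x : H) : ‖D x‖ ^ 2 = ‖x‖ ^ 2 - ‖a x‖ ^ 2 := by
  have h1 : ⟪D x, D x⟫_ℂ = ⟪x, x⟫_ℂ - ⟪a x, a x⟫_ℂ := by
    have e1 : ⟪D x, D x⟫_ℂ = ⟪x, D (D x)⟫_ℂ := hD.isSymmetric x _
    have e2 : ⟪a x, a x⟫_ℂ = ⟪x, a (a x)⟫_ℂ := ha.isSymmetric x _
    have e3 : D (D x) = x - a (a x) := by
      change (D * D) x = _
      rw [h]; rfl
    rw [e1, e2, e3, inner_sub_right]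
  have := congrArg Complex.re h1
  rw [Complex.sub_re] at this
  have n := fun z : H => norm_sq_eq_re_inner (𝕜 := ℂ) z
  simp only [n]
  exact this

theorem aux_rot {H : Type*} [NormedAddCommGroup H] [InnerProductSpace ℂ H]
    [CompleteSpace H]
    (a D : H →L[ℂ] H) (ha : IsSelfAdjoint a) (hD : IsSelfAdjoint D)
    (h : D * D = 1 - a * a) (hc : D * a = a * D) (u v : H) :
    ‖a u + D v‖ ^ 2 + ‖D u - a v‖ ^ 2 = ‖u‖ ^ 2 + ‖v‖ ^ 2 := by
  have h1 : ⟪a u, D v⟫_ℂ = ⟪D u, a v⟫_ℂ := by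
    have e1 : ⟪D (a u), v⟫_ℂ = ⟪a u, D v⟫_ℂ := hD.isSymmetric _ _
    have e2 : ⟪a (D u), v⟫_ℂ = ⟪D u, a v⟫_ℂ := ha.isSymmetric _ _
    have e3 : D (a u) = a (D u) := congrArg (fun T : H →L[ℂ] H => T u) hc
    rw [← e1, ← e2, e3]
  rw [norm_add_sq (𝕜 := ℂ), norm_sub_sq (𝕜 := ℂ), h1, aux_defect_norm a D ha hD h,
    aux_defect_norm a D ha hD h]
  ring

/-- Krein's extension theorem, normalized. -/
theorem aux_krein_one {H : Type*} [NormedAddCommGroup H] [InnerProductSpace ℂ H]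
    [CompleteSpace H]
    (P : H →L[ℂ] H) (hP : IsSelfAdjoint P) (hPi : P * P = P)
    (A : H →L[ℂ] H) (hA : IsSelfAdjoint A) (hn : ‖P * A‖ ≤ 1) :
    ∃ Z : H →L[ℂ] H, IsSelfAdjoint Z ∧ Z = (1 - P) * Z * (1 - P) ∧ ‖A + Z‖ ≤ 1 := by
  have hPs : star P = P := hP
  have hAs : star A = A := hA
  have hR : star (1 - P) = 1 - P := by rw [star_sub, star_one, hPs]
  have hRi : (1 - P) * (1 - P) = 1 - P := by
    rw [mul_sub, sub_mul, sub_mul, hPi]; simp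
  have hAP : ‖A * P‖ ≤ 1 := by
    rw [← norm_star, star_mul, hPs, hAs]; exact hn
  have hAPx : ∀ x, ‖A (P x)‖ ≤ ‖x‖ := fun x => by
    have := (A * P).le_of_opNorm_le hAP x
    rwa [one_mul] at this
  have hsplit : ∀ x : H, ‖x‖ ^ 2 = ‖P x‖ ^ 2 + ‖(1 - P) x‖ ^ 2 := fun x => by
    rw [← aux_pyth P hP hPi]
    congr 2
    simp
  obtain ⟨a, ha⟩ : ∃ a, a = P * A * P := ⟨_, rfl⟩
  obtain ⟨b, hb⟩ : ∃ b, b = (1 - P) * A * P := ⟨_, rfl⟩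
  have has : IsSelfAdjoint a := by
    change star a = a
    rw [ha, star_mul, star_mul, hPs, hAs, mul_assoc]
  have hab : ∀ x, ‖a x‖ ^ 2 + ‖b x‖ ^ 2 ≤ ‖x‖ ^ 2 := fun x => by
    have h1 := hsplit (A (P x))
    have h2 : a x = P (A (P x)) := by rw [ha]; rfl
    have h3 : b x = (1 - P) (A (P x)) := by rw [hb]; rfl
    rw [h2, h3, ← h1]
    exact pow_le_pow_left₀ (norm_nonneg _) (hAPx x) 2
  have han : ‖a‖ ≤ 1 := by
    refine ContinuousLinearMap.opNorm_le_bound _ zero_le_one fun x => ?_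
    rw [one_mul]
    refine aux_sq_le ?_ (norm_nonneg _)
    nlinarith [hab x, sq_nonneg ‖b x‖]
  obtain ⟨D, hDs, hDD, hDa⟩ := aux_defect a has han
  obtain ⟨k0, hk0, hk0D⟩ := aux_douglas b D fun x => by
    refine aux_sq_le ?_ (norm_nonneg _)
    rw [aux_defect_norm a D has hDs hDD]
    linarith [hab x]
  have hDst : star D = D := hDs
  have hast : star a = a := has
  obtain ⟨k, hk⟩ : ∃ k, k = (1 - P) * k0 := ⟨_, rfl⟩
  have hRk : (1 - P) * k = k := by rw [hk, ← mul_assoc, hRi]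
  have hkR : star k * (1 - P) = star k := by
    conv_rhs => rw [← hRk, star_mul, hR]
  have hkD : k * D = b := by
    rw [hk, mul_assoc, hk0D, hb, ← mul_assoc, ← mul_assoc, hRi]
  have hDk : D * star k = star b := by
    rw [← hkD, star_mul, hDst]
  have hRx : ∀ x, ‖(1 - P) x‖ ≤ ‖x‖ := fun x => by
    refine aux_sq_le ?_ (norm_nonneg _)
    nlinarith [hsplit x, sq_nonneg ‖P x‖]
  have hkx : ∀ x, ‖k x‖ ≤ ‖x‖ := fun x => by
    rw [hk]
    refine (hRx (k0 x)).trans ?_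
    simpa using k0.le_of_opNorm_le hk0 x
  have hkn : ‖star k‖ ≤ 1 := by
    rw [norm_star]
    exact ContinuousLinearMap.opNorm_le_bound _ zero_le_one fun x => by simpa using hkx x
  have hksx : ∀ x, ‖star k x‖ ≤ ‖(1 - P) x‖ := fun x => by
    have h1 : star k x = star k ((1 - P) x) := by
      conv_lhs => rw [← hkR]
      rfl
    rw [h1]
    simpa using (star k).le_of_opNorm_le hkn ((1 - P) x)
  refine ⟨-(k * a * star k) - (1 - P) * A * (1 - P), ?_, ?_, ?_⟩
  · change star _ = _
    simp only [star_sub, star_neg, star_mul, star_star, hast, hAs, hPs, star_one, mul_assoc]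
  · have e1 : (1 - P) * (k * a * star k) * (1 - P) = k * a * star k := by
      calc _ = ((1 - P) * k) * a * (star k * (1 - P)) := by noncomm_ring
        _ = _ := by rw [hRk, hkR]
    have e2 : (1 - P) * ((1 - P) * A * (1 - P)) * (1 - P) = (1 - P) * A * (1 - P) := by
      calc _ = ((1 - P) * (1 - P)) * A * ((1 - P) * (1 - P)) := by simp only [mul_assoc]
        _ = _ := by rw [hRi]
    rw [mul_sub (1 - P) (-(k * a * star k)), sub_mul _ _ (1 - P), e2, mul_neg, neg_mul, e1]
  · have hM : A + (-(k * a * star k) - (1 - P) * A * (1 - P))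
        = P * (a * P + D * star k) + (1 - P) * (k * (D * P - a * star k)) := by
      have e1 : P * a * P = a := by
        rw [ha]
        calc _ = (P * P) * A * (P * P) := by simp only [mul_assoc]
          _ = _ := by rw [hPi]
      have hbs : star b = P * A * (1 - P) := by
        rw [hb, star_mul, star_mul, hPs, hAs, hR, mul_assoc]
      have e2 : P * star b = star b := by
        rw [hbs, ← mul_assoc, ← mul_assoc, hPi]
      have e3 : b * P = b := by rw [hb, mul_assoc, hPi]
      calc A + (-(k * a * star k) - (1 - P) * A * (1 - P))
          = P * A * P + P * A * (1 - P) + (1 - P) * A * P - k * a * star k := by noncomm_ring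
        _ = a + star b + b - k * a * star k := by rw [hbs, ← ha, ← hb]
        _ = P * a * P + P * (D * star k) + (k * D) * P - k * a * star k := by
            rw [e1, hDk, e2, hkD, e3]
        _ = P * (a * P + D * star k) + k * (D * P - a * star k) := by noncomm_ring
        _ = _ := by
            rw [← mul_assoc (1 - P) k, hRk]
    rw [hM]
    refine ContinuousLinearMap.opNorm_le_bound _ zero_le_one fun x => ?_
    rw [one_mul]
    refine aux_sq_le ?_ (norm_nonneg _)
    change ‖P (a (P x) + D (star k x)) + (1 - P) (k (D (P x) - a (star k x)))‖ ^ 2 ≤ _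
    rw [aux_pyth P hP hPi]
    have r := aux_rot a D has hDs hDD hDa (P x) (star k x)
    have i1 : ‖P (a (P x) + D (star k x))‖ ^ 2 ≤ ‖a (P x) + D (star k x)‖ ^ 2 := by
      nlinarith [hsplit (a (P x) + D (star k x)), sq_nonneg ‖(1 - P) (a (P x) + D (star k x))‖]
    have i2 := pow_le_pow_left₀ (norm_nonneg _)
      ((hRx (k (D (P x) - a (star k x)))).trans (hkx _)) 2
    have i3 := pow_le_pow_left₀ (norm_nonneg _) (hksx x) 2
    linarith [hsplit x]

/-- Krein's extension theorem, anti-Hermitian version. -/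
theorem aux_krein {H : Type*} [NormedAddCommGroup H] [InnerProductSpace ℂ H]
    [CompleteSpace H]
    (P : H →L[ℂ] H) (hP : IsSelfAdjoint P) (hPi : P * P = P)
    (X : H →L[ℂ] H) (hX : adjoint X = -X) :
    ∃ Z : H →L[ℂ] H, adjoint Z = -Z ∧ Z = (1 - P) * Z * (1 - P) ∧ ‖X + Z‖ ≤ ‖P * X‖ := by
  simp only [← star_eq_adjoint] at *
  have hPs : star P = P := hP
  rcases (norm_nonneg (P * X)).eq_or_lt with h0 | hpos
  · have hPX : P * X = 0 := norm_eq_zero.mp h0.symm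
    have hXP : X * P = 0 := by
      have := congrArg star hPX
      rw [star_mul, hPs, hX, star_zero, neg_mul, neg_eq_zero] at this
      exact this
    refine ⟨-X, by rw [star_neg, hX], ?_, ?_⟩
    · have e1 : (1 - P) * X = X := by rw [sub_mul, hPX, one_mul, sub_zero]
      have e2 : X * (1 - P) = X := by rw [mul_sub, hXP, mul_one, sub_zero]
      rw [mul_neg, neg_mul, e1, e2]
    · rw [add_neg_cancel, norm_zero]; exact norm_nonneg _
  · set c := ‖P * X‖ with hc
    obtain ⟨z, hz⟩ : ∃ z : ℂ, z = (c : ℂ)⁻¹ * Complex.I := ⟨_, rfl⟩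
    have hc0 : (c : ℂ) ≠ 0 := by exact_mod_cast hpos.ne'
    have hz0 : z ≠ 0 := by rw [hz]; exact mul_ne_zero (inv_ne_zero hc0) Complex.I_ne_zero
    have hzn : ‖z‖ = c⁻¹ := by
      rw [hz, norm_mul, Complex.norm_I, mul_one, norm_inv, Complex.norm_real, Real.norm_eq_abs,
        abs_of_pos hpos]
    have hzs : star z = -z := by
      rw [hz, star_mul', star_inv₀]
      simp
    obtain ⟨Z, hZ1, hZ2, hZ3⟩ := aux_krein_one P hP hPi (z • X)
      (by change star _ = _
          rw [star_smul, hzs, hX]; simp)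
      (by rw [mul_smul_comm, norm_smul, hzn, ← hc, inv_mul_cancel₀ hpos.ne'])
    have hZs : star Z = Z := hZ1
    refine ⟨z⁻¹ • Z, ?_, ?_, ?_⟩
    · rw [star_smul, star_inv₀, hzs, hZs, inv_neg, neg_smul]
    · rw [mul_smul_comm, smul_mul_assoc, ← hZ2]
    · have : X + z⁻¹ • Z = z⁻¹ • (z • X + Z) := by
        rw [smul_add, smul_smul, inv_mul_cancel₀ hz0, one_smul]
      rw [this, norm_smul, norm_inv, hzn, inv_inv]
      nlinarith

theorem aux_norm_P {H : Type*} [NormedAddCommGroup H] [InnerProductSpace ℂ H]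
    [CompleteSpace H]
    (P : H →L[ℂ] H) (hP : IsSelfAdjoint P) (hPi : P * P = P) (T : H →L[ℂ] H) :
    ‖P * T‖ ≤ ‖T‖ := by
  refine ContinuousLinearMap.opNorm_le_bound _ (norm_nonneg _) fun x => ?_
  refine le_trans ?_ (T.le_opNorm x)
  change ‖P (T x)‖ ≤ _
  have h := aux_pyth P hP hPi (T x) (T x)
  have e : P (T x) + (1 - P) (T x) = T x := by simp
  rw [e] at h
  refine aux_sq_le ?_ (norm_nonneg _)
  nlinarith [sq_nonneg ‖(1 - P) (T x)‖]

/-- Two-step characterization of minimal liftings.  Let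
`Q0 = P0 − f0⊗f0`.  If `Y0` (supported in `R(P0) ⊖ ⟨f0⟩`) minimizes the first-row norm
`‖P0(X+Y)‖` and `Z0` (supported in `N(P0)`) minimizes `‖X+Y0+Z‖`, then `X0 = X+Y0+Z0`
is a minimal lifting.  Conversely every minimal lifting `X1 = X+Y1+Z1` arises this way:
`Y1` minimizes the first-row norm and `Z1` minimizes `‖X+Y1+Z‖`. -/
theorem minimal_lifting_two_step
    {H : Type*} [NormedAddCommGroup H] [InnerProductSpace ℂ H] [CompleteSpace H]
    (P0 : H →L[ℂ] H) (hP0sa : IsSelfAdjoint P0) (hP0idem : P0 * P0 = P0)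
    (f0 : H) (hf0 : ‖f0‖ = 1) (hf0fix : P0 f0 = f0)
    (X : H →L[ℂ] H) (hX : adjoint X = -X) :
    ((∀ Y0 Z0 : H →L[ℂ] H,
      adjoint Y0 = -Y0 →
      Y0 = (P0 - rankOne f0 f0) * Y0 * (P0 - rankOne f0 f0) →
      (∀ Y : H →L[ℂ] H, adjoint Y = -Y →
        Y = (P0 - rankOne f0 f0) * Y * (P0 - rankOne f0 f0) →
        ‖P0 * (X + Y0)‖ ≤ ‖P0 * (X + Y)‖) →
      adjoint Z0 = -Z0 →
      Z0 = (1 - P0) * Z0 * (1 - P0) →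
      (∀ Z : H →L[ℂ] H, adjoint Z = -Z → Z = (1 - P0) * Z * (1 - P0) →
        ‖X + Y0 + Z0‖ ≤ ‖X + Y0 + Z‖) →
      -- then `X0 = X + Y0 + Z0` is a minimal lifting:
      ∀ W : H →L[ℂ] H, adjoint W = -W → W * P0 = P0 * W → W f0 = 0 →
        ‖X + Y0 + Z0‖ ≤ ‖X + W‖)) ∧
    (∀ Y1 Z1 : H →L[ℂ] H,
      adjoint Y1 = -Y1 →
      Y1 = (P0 - rankOne f0 f0) * Y1 * (P0 - rankOne f0 f0) →
      adjoint Z1 = -Z1 →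
      Z1 = (1 - P0) * Z1 * (1 - P0) →
      -- if `X1 = X + Y1 + Z1` is a minimal lifting ...
      (∀ W : H →L[ℂ] H, adjoint W = -W → W * P0 = P0 * W → W f0 = 0 →
        ‖X + Y1 + Z1‖ ≤ ‖X + W‖) →
      -- ... then `Y1` minimizes the first row and `Z1` solves Krein's problem:
      (∀ Y : H →L[ℂ] H, adjoint Y = -Y →
        Y = (P0 - rankOne f0 f0) * Y * (P0 - rankOne f0 f0) →
        ‖P0 * (X + Y1)‖ ≤ ‖P0 * (X + Y)‖) ∧
      (∀ Z : H →L[ℂ] H, adjoint Z = -Z → Z = (1 - P0) * Z * (1 - P0) →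
        ‖X + Y1 + Z1‖ ≤ ‖X + Y1 + Z‖)) := by
  have hPs : star P0 = P0 := hP0sa
  have hrs : star (rankOne f0 f0) = rankOne f0 f0 := by
    rw [star_eq_adjoint]
    symm
    rw [ContinuousLinearMap.eq_adjoint_iff]
    intro x y
    simp [rankOne, inner_smul_left, inner_smul_right, mul_comm]
  have hPr : P0 * rankOne f0 f0 = rankOne f0 f0 := by
    ext x
    simp [rankOne, hf0fix]
  have hrP : rankOne f0 f0 * P0 = rankOne f0 f0 := by
    have := congrArg star hPr
    rwa [star_mul, hPs, hrs] at this
  have hff : ⟪f0, f0⟫_ℂ = 1 := by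
    rw [inner_self_eq_norm_sq_to_K, hf0]; simp
  have hPQ : P0 * (P0 - rankOne f0 f0) = P0 - rankOne f0 f0 := by rw [mul_sub, hP0idem, hPr]
  have hQP : (P0 - rankOne f0 f0) * P0 = P0 - rankOne f0 f0 := by rw [sub_mul, hP0idem, hrP]
  have hQf : (P0 - rankOne f0 f0) f0 = 0 := by
    simp [rankOne, hf0fix, hf0]
  have hRP : (1 - P0) * P0 = 0 := by rw [sub_mul, hP0idem]; simp
  have hPR : P0 * (1 - P0) = 0 := by rw [mul_sub, hP0idem]; simp
  have hPZ : ∀ Z : H →L[ℂ] H, Z = (1 - P0) * Z * (1 - P0) → P0 * Z = 0 ∧ Z * P0 = 0 := by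
    intro Z hZ
    constructor
    · rw [hZ, ← mul_assoc, ← mul_assoc, hPR, zero_mul, zero_mul]
    · rw [hZ, mul_assoc, hRP, mul_zero]
  -- every pair gives a vertical vector
  have hvert : ∀ Y Z : H →L[ℂ] H, adjoint Y = -Y →
      Y = (P0 - rankOne f0 f0) * Y * (P0 - rankOne f0 f0) → adjoint Z = -Z →
      Z = (1 - P0) * Z * (1 - P0) →
      adjoint (Y + Z) = -(Y + Z) ∧ (Y + Z) * P0 = P0 * (Y + Z) ∧ (Y + Z) f0 = 0 := by
    intro Y Z hYa hY hZa hZ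
    refine ⟨by rw [map_add, hYa, hZa, neg_add], ?_, ?_⟩
    · rw [add_mul, mul_add, (hPZ Z hZ).1, (hPZ Z hZ).2]
      have e1 : Y * P0 = Y := by
        rw [hY, mul_assoc, hQP]
      have e2 : P0 * Y = Y := by
        rw [hY, ← mul_assoc, ← mul_assoc, hPQ]
      rw [e1, e2]
    · have e1 : Y f0 = 0 := by
        rw [hY]
        change (P0 - rankOne f0 f0) (Y ((P0 - rankOne f0 f0) f0)) = 0
        rw [hQf, map_zero, map_zero]
      have e2 : Z f0 = 0 := by
        have := congrArg (fun T : H →L[ℂ] H => T f0) (hPZ Z hZ).2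
        change Z (P0 f0) = 0 at this
        rwa [hf0fix] at this
      change Y f0 + Z f0 = 0
      rw [e1, e2, add_zero]
  -- Krein for X + Y
  have hkr : ∀ Y : H →L[ℂ] H, adjoint Y = -Y → ∃ Z : H →L[ℂ] H, adjoint Z = -Z ∧
      Z = (1 - P0) * Z * (1 - P0) ∧ ‖X + Y + Z‖ ≤ ‖P0 * (X + Y)‖ := fun Y hY =>
    aux_krein P0 hP0sa hP0idem (X + Y) (by rw [map_add, hX, hY, neg_add])
  constructor
  · intro Y0 Z0 hY0a hY0 hYmin hZ0a hZ0 hZmin W hWa hWP hWf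
    obtain ⟨Z, hZa, hZ, hZn⟩ := hkr Y0 hY0a
    have hWr : W * rankOne f0 f0 = 0 := by
      ext x
      simp [rankOne, hWf]
    have hrW : rankOne f0 f0 * W = 0 := by
      have := congrArg star hWr
      rw [star_mul, hrs, star_eq_adjoint W, hWa, star_zero, mul_neg, neg_eq_zero] at this
      exact this
    have hQW : (P0 - rankOne f0 f0) * (P0 * W) * (P0 - rankOne f0 f0) = P0 * W := by
      rw [← mul_assoc, hQP, sub_mul, hrW, sub_zero, mul_sub, mul_assoc, mul_assoc, hWr, mul_zero,
        sub_zero, hWP, ← mul_assoc, hP0idem]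
    have hPWa : adjoint (P0 * W) = -(P0 * W) := by
      rw [← star_eq_adjoint, star_mul, hPs, star_eq_adjoint, hWa, neg_mul, hWP]
    have h1 := hYmin (P0 * W) hPWa hQW.symm
    have h2 : P0 * (X + P0 * W) = P0 * (X + W) := by
      rw [mul_add, mul_add, ← mul_assoc, hP0idem]
    rw [h2] at h1
    exact (hZmin Z hZa hZ).trans (hZn.trans (h1.trans (aux_norm_P P0 hP0sa hP0idem _)))
  · intro Y1 Z1 hY1a hY1 hZ1a hZ1 hmin
    constructor
    · intro Y hYa hY
      obtain ⟨Z, hZa, hZ, hZn⟩ := hkr Y hYa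
      obtain ⟨v1, v2, v3⟩ := hvert Y Z hYa hY hZa hZ
      have h1 := hmin (Y + Z) v1 v2 v3
      rw [← add_assoc] at h1
      have h2 : P0 * (X + Y1) = P0 * (X + Y1 + Z1) := by
        rw [mul_add P0 (X + Y1) Z1, (hPZ Z1 hZ1).1, add_zero]
      rw [h2]
      exact (aux_norm_P P0 hP0sa hP0idem _).trans (h1.trans hZn)
    · intro Z hZa hZ
      obtain ⟨v1, v2, v3⟩ := hvert Y1 Z hY1a hY1 hZa hZ
      have h1 := hmin (Y1 + Z) v1 v2 v3
      rwa [← add_assoc] at h1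
end

section
/- Let H be a complex Hilbert space, P0 an orthogonal projection, f0 a unit vector with P0 f0 = f0, and P0⊥ = 1 − P0. Define Π(X,f) = (Π₁(X,f), Π₂(X,f)) on B₂(H)_h × H by Π₁(X,f) = P0⊥ X P0 + P0 X P0⊥ + (1/3) f0⊗(P0⊥ f) + (1/3)(P0⊥ f)⊗f0 − (1/3) (f0⊗f0) X P0⊥ − (1/3) P0⊥ X (f0⊗f0) and Π₂(X,f) = i·Im⟨f,f0⟩ f0 + (P0 − f0⊗f0) f + (2/3) P0⊥ X f0 + (1/3) P0⊥ f. Then Π is the orthogonal projection of the real Hilbert space B₂(H)_h × H, with inner product ⟨(X,f),(Y,g)⟩ = Tr(XY) + Re⟨f,g⟩, onto the tangent space {(Z P0 − P0 Z, Z f0) : Z ∈ B₂(H), Z* = −Z}: it is real-linear, idempotent, self-adjoint for this inner product, and has range equal to the tangent space. -/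
open scoped InnerProductSpace
open ContinuousLinearMap

/-- `X` is a Hilbert–Schmidt operator, expressed via the Hilbert basis `e`. -/
def IsHilbertSchmidt {H : Type*} [NormedAddCommGroup H] [InnerProductSpace ℂ H]
    [CompleteSpace H] {ι : Type*} (e : HilbertBasis ι ℂ H) (X : H →L[ℂ] H) : Prop :=
  Summable fun i => ‖X (e i)‖ ^ 2

/-- `Tr(X Y)` for selfadjoint Hilbert–Schmidt operators, computed as
`∑ᵢ Re ⟪X eᵢ, Y eᵢ⟫` via the Hilbert basis `e`. -/
noncomputable def hsReInner {H : Type*} [NormedAddCommGroup H] [InnerProductSpace ℂ H]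
    [CompleteSpace H] {ι : Type*} (e : HilbertBasis ι ℂ H) (X Y : H →L[ℂ] H) : ℝ :=
  ∑' i, ((⟪X (e i), Y (e i)⟫_ℂ : ℂ)).re

/-- The inner product `⟨(X,f),(Y,g)⟩ = Tr(XY) + Re⟨f,g⟩` on `B₂(H)_h × H`. -/
noncomputable def pairInner {H : Type*} [NormedAddCommGroup H] [InnerProductSpace ℂ H]
    [CompleteSpace H] {ι : Type*} (e : HilbertBasis ι ℂ H)
    (x y : (H →L[ℂ] H) × H) : ℝ :=
  hsReInner e x.1 y.1 + ((⟪x.2, y.2⟫_ℂ : ℂ)).re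

/-- The map `Π = (Π₁, Π₂)` of the paper (formulas (10), (11), (12)). -/
noncomputable def PiMap {H : Type*} [NormedAddCommGroup H] [InnerProductSpace ℂ H]
    [CompleteSpace H] (P0 : H →L[ℂ] H) (f0 : H) :
    (H →L[ℂ] H) × H → (H →L[ℂ] H) × H :=
  fun Xf =>
    ((1 - P0) * Xf.1 * P0 + P0 * Xf.1 * (1 - P0)
        + (1 / 3 : ℝ) • rankOne f0 ((1 - P0) Xf.2)
        + (1 / 3 : ℝ) • rankOne ((1 - P0) Xf.2) f0
        - (1 / 3 : ℝ) • (rankOne f0 f0 * Xf.1 * (1 - P0))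
        - (1 / 3 : ℝ) • ((1 - P0) * Xf.1 * rankOne f0 f0),
      (Complex.I * (((⟪f0, Xf.2⟫_ℂ : ℂ)).im : ℂ)) • f0 + (P0 - rankOne f0 f0) Xf.2
        + (2 / 3 : ℝ) • (1 - P0) (Xf.1 f0) + (1 / 3 : ℝ) • (1 - P0) Xf.2)

set_option linter.unusedSimpArgs false
set_option linter.unusedSectionVars false

theorem op_mul_app {H : Type*} [NormedAddCommGroup H] [InnerProductSpace ℂ H]
    (A B : H →L[ℂ] H) (z : H) : (A * B) z = A (B z) := rfl

theorem op_one_app {H : Type*} [NormedAddCommGroup H] [InnerProductSpace ℂ H]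
    (z : H) : (1 : H →L[ℂ] H) z = z := rfl

theorem rankOne_app {H : Type*} [NormedAddCommGroup H] [InnerProductSpace ℂ H]
    (x y z : H) : rankOne x y z = (⟪y, z⟫_ℂ) • x := by
  simp [rankOne]

section HS
variable {H : Type*} [NormedAddCommGroup H] [InnerProductSpace ℂ H] [CompleteSpace H]
  {ι : Type*} (e : HilbertBasis ι ℂ H)

theorem hs_parseval (x : H) : HasSum (fun i => ‖⟪e i, x⟫_ℂ‖ ^ 2) (‖x‖ ^ 2) := by
  have h := e.hasSum_inner_mul_inner x x
  have h2 := Complex.hasSum_re h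
  have h3 : (⟪x, x⟫_ℂ).re = ‖x‖ ^ 2 := by
    simpa using (inner_self_eq_norm_sq (𝕜 := ℂ) x)
  rw [h3] at h2
  convert h2 using 2 with i
  rw [← inner_conj_symm x (e i), ← Complex.normSq_eq_conj_mul_self, Complex.ofReal_re,
    Complex.normSq_eq_norm_sq]

theorem hs_enn (x : H) : ∑' i, ENNReal.ofReal (‖⟪e i, x⟫_ℂ‖ ^ 2) = ENNReal.ofReal (‖x‖ ^ 2) := by
  rw [← (hs_parseval e x).tsum_eq,
    ENNReal.ofReal_tsum_of_nonneg (fun i => by positivity) (hs_parseval e x).summable]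

theorem hs_enn_adj (X : H →L[ℂ] H) :
    ∑' i, ENNReal.ofReal (‖adjoint X (e i)‖ ^ 2) = ∑' i, ENNReal.ofReal (‖X (e i)‖ ^ 2) := by
  simp_rw [← hs_enn e]
  rw [ENNReal.tsum_comm]
  refine tsum_congr fun i => tsum_congr fun j => ?_
  rw [adjoint_inner_right, norm_inner_symm]

theorem hs_iff (X : H →L[ℂ] H) :
    IsHilbertSchmidt e X ↔ ∑' i, ENNReal.ofReal (‖X (e i)‖ ^ 2) ≠ ⊤ := by
  constructor
  · intro h
    rw [← ENNReal.ofReal_tsum_of_nonneg (fun i => by positivity) h]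
    exact ENNReal.ofReal_ne_top
  · intro h
    have := ENNReal.summable_toReal h
    refine this.congr fun i => ?_
    rw [ENNReal.toReal_ofReal (by positivity)]

theorem hs_adj {X : H →L[ℂ] H} (h : IsHilbertSchmidt e X) : IsHilbertSchmidt e (adjoint X) := by
  rw [hs_iff] at *
  rwa [hs_enn_adj]

theorem hs_sum_adj {X : H →L[ℂ] H} (h : IsHilbertSchmidt e X) :
    ∑' i, ‖adjoint X (e i)‖ ^ 2 = ∑' i, ‖X (e i)‖ ^ 2 := by
  have h1 := hs_enn_adj e X
  rw [← ENNReal.ofReal_tsum_of_nonneg (fun i => by positivity) h,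
    ← ENNReal.ofReal_tsum_of_nonneg (fun i => by positivity) (hs_adj e h)] at h1
  rwa [ENNReal.ofReal_eq_ofReal_iff (tsum_nonneg fun i => by positivity)
    (tsum_nonneg fun i => by positivity)] at h1

theorem hs_add {X Y : H →L[ℂ] H} (hX : IsHilbertSchmidt e X) (hY : IsHilbertSchmidt e Y) :
    IsHilbertSchmidt e (X + Y) := by
  refine Summable.of_nonneg_of_le (fun i => by positivity) (fun i => ?_)
    ((Summable.mul_left 2 hX).add (Summable.mul_left 2 hY))
  have h := norm_add_le (X (e i)) (Y (e i))
  have h0 := norm_nonneg (X (e i) + Y (e i))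
  simp only [add_apply]
  nlinarith [sq_nonneg (‖X (e i)‖ - ‖Y (e i)‖)]

theorem hs_smul {X : H →L[ℂ] H} (r : ℝ) (hX : IsHilbertSchmidt e X) :
    IsHilbertSchmidt e (r • X) := by
  refine (Summable.mul_left (r ^ 2) hX).congr fun i => ?_
  simp [norm_smul, mul_pow]

theorem hs_neg {X : H →L[ℂ] H} (hX : IsHilbertSchmidt e X) : IsHilbertSchmidt e (-X) := by
  simpa using hs_smul e (-1) hX

theorem hs_sub {X Y : H →L[ℂ] H} (hX : IsHilbertSchmidt e X) (hY : IsHilbertSchmidt e Y) :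
    IsHilbertSchmidt e (X - Y) := by
  rw [sub_eq_add_neg]
  exact hs_add e hX (hs_neg e hY)

theorem hs_mul_left (A : H →L[ℂ] H) {X : H →L[ℂ] H} (hX : IsHilbertSchmidt e X) :
    IsHilbertSchmidt e (A * X) := by
  refine Summable.of_nonneg_of_le (fun i => by positivity) (fun i => ?_)
    (Summable.mul_left (‖A‖ ^ 2) hX)
  rw [← mul_pow]
  gcongr
  exact A.le_opNorm _

theorem hs_mul_right (A : H →L[ℂ] H) {X : H →L[ℂ] H} (hX : IsHilbertSchmidt e X) :
    IsHilbertSchmidt e (X * A) := by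
  have h := hs_adj e (hs_mul_left e (adjoint A) (hs_adj e hX))
  have h2 : adjoint (adjoint A * adjoint X) = X * A := by
    simp [← star_eq_adjoint]
  rwa [h2] at h

theorem hs_rankOne (x y : H) : IsHilbertSchmidt e (rankOne x y) := by
  refine ((hs_parseval e y).summable.mul_right (‖x‖ ^ 2)).congr fun i => ?_
  rw [rankOne_app, norm_smul, mul_pow, norm_inner_symm]

theorem hs_summable {X Y : H →L[ℂ] H} (hX : IsHilbertSchmidt e X) (hY : IsHilbertSchmidt e Y) :
    Summable fun i => (⟪X (e i), Y (e i)⟫_ℂ).re := by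
  have h := ((hs_add e hX hY).sub (hs_sub e hX hY)).mul_left (1 / 4)
  refine h.congr fun i => ?_
  have h1 := norm_add_sq (𝕜 := ℂ) (X (e i)) (Y (e i))
  have h2 := norm_sub_sq (𝕜 := ℂ) (X (e i)) (Y (e i))
  simp only [add_apply, sub_apply, h1, h2, RCLike.re_eq_complex_re]
  ring

theorem hsR_polar {X Y : H →L[ℂ] H} (hX : IsHilbertSchmidt e X) (hY : IsHilbertSchmidt e Y) :
    hsReInner e X Y =
      (1 / 4) * (∑' i, ‖(X + Y) (e i)‖ ^ 2 - ∑' i, ‖(X - Y) (e i)‖ ^ 2) := by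
  rw [← Summable.tsum_sub (hs_add e hX hY) (hs_sub e hX hY), ← tsum_mul_left]
  refine tsum_congr fun i => ?_
  have h1 := norm_add_sq (𝕜 := ℂ) (X (e i)) (Y (e i))
  have h2 := norm_sub_sq (𝕜 := ℂ) (X (e i)) (Y (e i))
  simp only [add_apply, sub_apply, h1, h2, RCLike.re_eq_complex_re]
  ring

theorem hsR_adj {X Y : H →L[ℂ] H} (hX : IsHilbertSchmidt e X) (hY : IsHilbertSchmidt e Y) :
    hsReInner e (adjoint X) (adjoint Y) = hsReInner e X Y := by
  rw [hsR_polar e hX hY, hsR_polar e (hs_adj e hX) (hs_adj e hY), ← map_add, ← map_sub,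
    hs_sum_adj e (hs_add e hX hY), hs_sum_adj e (hs_sub e hX hY)]

theorem hsR_symm (X Y : H →L[ℂ] H) : hsReInner e X Y = hsReInner e Y X := by
  refine tsum_congr fun i => ?_
  rw [← inner_conj_symm, Complex.conj_re]

theorem hsR_add {X X' Y : H →L[ℂ] H} (hX : IsHilbertSchmidt e X) (hX' : IsHilbertSchmidt e X')
    (hY : IsHilbertSchmidt e Y) :
    hsReInner e (X + X') Y = hsReInner e X Y + hsReInner e X' Y := by
  unfold hsReInner
  rw [← Summable.tsum_add (hs_summable e hX hY) (hs_summable e hX' hY)]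
  simp [inner_add_left]

theorem hsR_sub {X X' Y : H →L[ℂ] H} (hX : IsHilbertSchmidt e X) (hX' : IsHilbertSchmidt e X')
    (hY : IsHilbertSchmidt e Y) :
    hsReInner e (X - X') Y = hsReInner e X Y - hsReInner e X' Y := by
  unfold hsReInner
  rw [← Summable.tsum_sub (hs_summable e hX hY) (hs_summable e hX' hY)]
  simp [inner_sub_left]

theorem hsR_smul (r : ℝ) (X Y : H →L[ℂ] H) :
    hsReInner e (r • X) Y = r * hsReInner e X Y := by
  unfold hsReInner
  rw [← tsum_mul_left]
  refine tsum_congr fun i => ?_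
  rw [smul_apply, ← Complex.coe_smul, inner_smul_left]
  simp

theorem hsR_mul_left (A X Y : H →L[ℂ] H) :
    hsReInner e (A * X) Y = hsReInner e X (adjoint A * Y) := by
  refine tsum_congr fun i => ?_
  simp [mul_apply, adjoint_inner_right]

theorem hsR_mul_right (A : H →L[ℂ] H) {X Y : H →L[ℂ] H} (hX : IsHilbertSchmidt e X)
    (hY : IsHilbertSchmidt e Y) :
    hsReInner e (X * A) Y = hsReInner e X (Y * adjoint A) := by
  rw [← hsR_adj e (hs_mul_right e A hX) hY, ← hsR_adj e hX (hs_mul_right e _ hY)]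
  have h1 : adjoint (X * A) = adjoint A * adjoint X := by simp [← star_eq_adjoint]
  have h2 : adjoint (Y * adjoint A) = A * adjoint Y := by simp [← star_eq_adjoint]
  rw [h1, h2, hsR_mul_left, adjoint_adjoint]

theorem hsR_sandwich {A B : H →L[ℂ] H} (hA : adjoint A = A) (hB : adjoint B = B)
    {X Y : H →L[ℂ] H} (hX : IsHilbertSchmidt e X)
    (hY : IsHilbertSchmidt e Y) :
    hsReInner e (A * X * B) Y = hsReInner e X (A * Y * B) := by
  rw [hsR_mul_right e B (hs_mul_left e A hX) hY, hsR_mul_left, hA, hB, mul_assoc]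

theorem hsR_rankOne (x y : H) (Y : H →L[ℂ] H) :
    hsReInner e (rankOne x y) Y = (⟪x, Y y⟫_ℂ).re := by
  have h := e.hasSum_inner_mul_inner (adjoint Y x) y
  rw [adjoint_inner_left] at h
  rw [← (Complex.hasSum_re h).tsum_eq]
  refine tsum_congr fun i => ?_
  rw [rankOne_app, inner_smul_left, inner_conj_symm, adjoint_inner_left, mul_comm]

theorem adjoint_rankOne' (x y : H) : adjoint (rankOne x y) = rankOne y x := by
  symm
  rw [eq_adjoint_iff]
  intro u v
  rw [rankOne_app, rankOne_app, inner_smul_left, inner_smul_right, inner_conj_symm]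
  ring

theorem hsR_comb {A B C D E F Y : H →L[ℂ] H}
    (hA : IsHilbertSchmidt e A) (hB : IsHilbertSchmidt e B) (hC : IsHilbertSchmidt e C)
    (hD : IsHilbertSchmidt e D) (hE : IsHilbertSchmidt e E) (hF : IsHilbertSchmidt e F)
    (hY : IsHilbertSchmidt e Y) (r : ℝ) :
    hsReInner e (A + B + r • C + r • D - r • E - r • F) Y =
      hsReInner e A Y + hsReInner e B Y + r * hsReInner e C Y + r * hsReInner e D Y
        - r * hsReInner e E Y - r * hsReInner e F Y := by
  have hC := hs_smul e r hC
  have hD := hs_smul e r hD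
  have hE := hs_smul e r hE
  have hF := hs_smul e r hF
  have h1 := hs_add e hA hB
  have h2 := hs_add e h1 hC
  have h3 := hs_add e h2 hD
  have h4 := hs_sub e h3 hE
  rw [hsR_sub e h4 hF hY, hsR_sub e h3 hE hY, hsR_add e h2 hD hY, hsR_add e h1 hC hY,
    hsR_add e hA hB hY]
  simp only [hsR_smul]

theorem Pi_tangent (P0 : H →L[ℂ] H) (hP0sa : IsSelfAdjoint P0) (hP0idem : P0 * P0 = P0)
    (f0 : H) (hf0 : ‖f0‖ = 1) (hf0fix : P0 f0 = f0)
    (Z : H →L[ℂ] H) (hZ : adjoint Z = -Z) :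
      PiMap P0 f0 (Z * P0 - P0 * Z, Z f0) = (Z * P0 - P0 * Z, Z f0) := by
  have hP : ∀ x y, ⟪P0 x, y⟫_ℂ = ⟪x, P0 y⟫_ℂ := fun x y => by
    rw [← adjoint_inner_right, hP0sa.adjoint_eq]
  have hPP : ∀ x, P0 (P0 x) = P0 x := fun x => congrArg (fun T : H →L[ℂ] H => T x) hP0idem
  have hZi : ∀ x y, ⟪Z x, y⟫_ℂ = -⟪x, Z y⟫_ℂ := fun x y => by
    rw [← adjoint_inner_right, hZ]; simp
  have hfP : ∀ y, ⟪f0, P0 y⟫_ℂ = ⟪f0, y⟫_ℂ := fun y => by rw [← hP, hf0fix]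
  have hc : Complex.I * ((⟪f0, Z f0⟫_ℂ).im : ℂ) = ⟪f0, Z f0⟫_ℂ := by
    have h := hZi f0 f0
    have h3 := congrArg Complex.re h
    have h4 : (⟪Z f0, f0⟫_ℂ).re = (⟪f0, Z f0⟫_ℂ).re := by
      rw [← inner_conj_symm, Complex.conj_re]
    rw [Complex.neg_re] at h3
    apply Complex.ext
    · simp; linarith
    · simp
  refine Prod.ext ?_ ?_
  · ext z
    simp only [PiMap, add_apply, sub_apply, smul_apply, op_mul_app, op_one_app, map_sub, hPP,
      hf0fix, rankOne_app, map_smul, inner_sub_left, inner_sub_right, hP, hfP, hZi]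
    module
  · simp only [PiMap, add_apply, sub_apply, smul_apply, op_mul_app, op_one_app, map_sub, hPP,
      hf0fix, rankOne_app, map_smul, hc]
    module

theorem Pi_range (P0 : H →L[ℂ] H) (hP0sa : IsSelfAdjoint P0) (hP0idem : P0 * P0 = P0)
    (f0 : H) (hf0 : ‖f0‖ = 1) (hf0fix : P0 f0 = f0)
    (X : H →L[ℂ] H) (f : H) (hX : IsHilbertSchmidt e X) (hXs : IsSelfAdjoint X) :
    ∃ Z : H →L[ℂ] H, IsHilbertSchmidt e Z ∧ adjoint Z = -Z ∧
        PiMap P0 f0 (X, f) = (Z * P0 - P0 * Z, Z f0) := by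
  have hP : ∀ x y, ⟪P0 x, y⟫_ℂ = ⟪x, P0 y⟫_ℂ := fun x y => by
    rw [← adjoint_inner_right, hP0sa.adjoint_eq]
  have hPP : ∀ x, P0 (P0 x) = P0 x := fun x => congrArg (fun T : H →L[ℂ] H => T x) hP0idem
  have hXi : ∀ x y, ⟪X x, y⟫_ℂ = ⟪x, X y⟫_ℂ := fun x y => by
    rw [← adjoint_inner_right, hXs.adjoint_eq]
  have hfP : ∀ y, ⟪f0, P0 y⟫_ℂ = ⟪f0, y⟫_ℂ := fun y => by rw [← hP, hf0fix]
  have hff : ⟪f0, f0⟫_ℂ = 1 := by rw [inner_self_eq_norm_sq_to_K, hf0]; simp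
  obtain ⟨b, hb⟩ : ∃ b : H →L[ℂ] H, b = (1 - P0) * X * P0
      + (1 / 3 : ℝ) • rankOne ((1 - P0) f) f0 - (1 / 3 : ℝ) • ((1 - P0) * X * rankOne f0 f0) :=
    ⟨_, rfl⟩
  obtain ⟨w, hw⟩ : ∃ w : H, w = (Complex.I * (((⟪f0, f⟫_ℂ : ℂ)).im : ℂ) / 2) • f0
      + (P0 - rankOne f0 f0) f := ⟨_, rfl⟩
  obtain ⟨T, hT⟩ : ∃ T : H →L[ℂ] H, T = b + rankOne w f0 := ⟨_, rfl⟩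
  have hTs : IsHilbertSchmidt e T := by
    rw [hT, hb]
    exact hs_add e (hs_sub e (hs_add e (hs_mul_right e _ (hs_mul_left e _ hX))
      (hs_smul e _ (hs_rankOne e _ _))) (hs_smul e _ (hs_mul_left e _ (hs_rankOne e _ _))))
      (hs_rankOne e _ _)
  have hTa : adjoint T = P0 * X * (1 - P0) + (1 / 3 : ℝ) • rankOne f0 ((1 - P0) f)
      - (1 / 3 : ℝ) • (rankOne f0 f0 * X * (1 - P0)) + rankOne f0 w := by
    symm
    rw [eq_adjoint_iff]
    intro x y
    simp only [hT, hb, add_apply, sub_apply, smul_apply, op_mul_app, op_one_app, map_sub,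
      hf0fix, rankOne_app, map_smul, inner_sub_left, inner_sub_right, inner_add_left,
      inner_add_right, inner_smul_left, inner_smul_right, hP, hXi, inner_conj_symm,
      ← Complex.coe_smul, Complex.conj_ofReal, map_sub]
    simp only [← hXi, ← hP, hf0fix]
    ring
  refine ⟨T - adjoint T, hs_sub e hTs (hs_adj e hTs), ?_, ?_⟩
  · simp
  · rw [hTa, hT, hb]
    refine Prod.ext ?_ ?_
    · ext z
      simp only [hw, PiMap, add_apply, sub_apply, smul_apply, op_mul_app, op_one_app, map_sub,
        map_add, hPP, hf0fix, rankOne_app, map_smul, inner_sub_left, inner_sub_right,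
        inner_add_left, inner_smul_left, hP, hfP, map_smul_of_tower]
      module
    · simp only [hw, PiMap, add_apply, sub_apply, smul_apply, op_mul_app, op_one_app, map_sub,
        map_add, hPP, hf0fix, rankOne_app, map_smul, inner_sub_left, inner_sub_right,
        inner_add_left, inner_smul_left, hP, hfP, hff, inner_conj_symm, map_zero, sub_self]
      have h2 : (starRingEnd ℂ) (2 : ℂ) = 2 := Complex.conj_ofNat 2
      simp [hff, h2, ← hP, hf0fix]
      module

end HS

/-- `Π` is the orthogonal projection of the real Hilbert space
`B₂(H)_h × H` (selfadjoint Hilbert–Schmidt operators times `H`, with inner product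
`⟨(X,f),(Y,g)⟩ = Tr(XY) + Re⟨f,g⟩`) onto the tangent space
`{(Z P0 − P0 Z, Z f0) : Z ∈ B₂(H), Z* = −Z}`: it is real-linear, idempotent,
self-adjoint for this inner product, and its range is the tangent space. -/
theorem PiMap_orthogonal_projection_onto_tangent
    {H : Type*} [NormedAddCommGroup H] [InnerProductSpace ℂ H] [CompleteSpace H]
    {ι : Type*} (e : HilbertBasis ι ℂ H)
    (P0 : H →L[ℂ] H) (hP0sa : IsSelfAdjoint P0) (hP0idem : P0 * P0 = P0)
    (f0 : H) (hf0 : ‖f0‖ = 1) (hf0fix : P0 f0 = f0) :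
    -- `Π` is real-linear
    (∀ (r : ℝ) (x y : (H →L[ℂ] H) × H),
      PiMap P0 f0 (r • x + y) = r • PiMap P0 f0 x + PiMap P0 f0 y) ∧
    -- `Π ∘ Π = Π` on `B₂(H)_h × H`
    (∀ (X : H →L[ℂ] H) (f : H), IsHilbertSchmidt e X → IsSelfAdjoint X →
      PiMap P0 f0 (PiMap P0 f0 (X, f)) = PiMap P0 f0 (X, f)) ∧
    -- `Π` is self-adjoint for the inner product on `B₂(H)_h × H`
    (∀ x y : (H →L[ℂ] H) × H,
      IsHilbertSchmidt e x.1 → IsSelfAdjoint x.1 →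
      IsHilbertSchmidt e y.1 → IsSelfAdjoint y.1 →
      pairInner e (PiMap P0 f0 x) y = pairInner e x (PiMap P0 f0 y)) ∧
    -- the range of `Π` lies in the tangent space ...
    (∀ (X : H →L[ℂ] H) (f : H), IsHilbertSchmidt e X → IsSelfAdjoint X →
      ∃ Z : H →L[ℂ] H, IsHilbertSchmidt e Z ∧ adjoint Z = -Z ∧
        PiMap P0 f0 (X, f) = (Z * P0 - P0 * Z, Z f0)) ∧
    -- ... and `Π` fixes the tangent space (so its range is exactly the tangent space)
    (∀ Z : H →L[ℂ] H, IsHilbertSchmidt e Z → adjoint Z = -Z →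
      PiMap P0 f0 (Z * P0 - P0 * Z, Z f0) = (Z * P0 - P0 * Z, Z f0)) := by
  refine ⟨?_, ?_, ?_, ?_, ?_⟩
  · intro r x y
    refine Prod.ext ?_ ?_
    · ext z
      simp only [PiMap, add_apply, sub_apply, smul_apply, op_mul_app, op_one_app, map_sub,
        map_add, rankOne_app, map_smul, inner_sub_left, Prod.fst_add, Prod.snd_add,
        Prod.smul_fst, Prod.smul_snd, inner_add_left, inner_smul_left, map_smul_of_tower,
        ← Complex.coe_smul, Complex.conj_ofReal]
      module
    · simp only [PiMap, add_apply, sub_apply, smul_apply, op_mul_app, op_one_app, map_sub,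
        map_add, rankOne_app, map_smul, inner_sub_left, Prod.fst_add, Prod.snd_add,
        Prod.smul_fst, Prod.smul_snd, inner_add_right, inner_smul_right, map_smul_of_tower,
        ← Complex.coe_smul, Complex.add_im, Complex.im_ofReal_mul, Complex.ofReal_add,
        Complex.ofReal_mul]
      module
  · intro X f hX hXs
    obtain ⟨Z, _, hZ, h⟩ := Pi_range e P0 hP0sa hP0idem f0 hf0 hf0fix X f hX hXs
    rw [h]
    exact Pi_tangent P0 hP0sa hP0idem f0 hf0 hf0fix Z hZ
  · rintro ⟨X, f⟩ ⟨Y, g⟩ hX hXs hY hYs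
    dsimp only at hX hXs hY hYs
    have hPa : adjoint P0 = P0 := hP0sa.adjoint_eq
    have hP : ∀ x y, ⟪P0 x, y⟫_ℂ = ⟪x, P0 y⟫_ℂ := fun x y => by
      rw [← adjoint_inner_right, hPa]
    have hXi : ∀ x y, ⟪X x, y⟫_ℂ = ⟪x, X y⟫_ℂ := fun x y => by
      rw [← adjoint_inner_right, hXs.adjoint_eq]
    have hYi : ∀ x y, ⟪Y x, y⟫_ℂ = ⟪x, Y y⟫_ℂ := fun x y => by
      rw [← adjoint_inner_right, hYs.adjoint_eq]
    have hQa : adjoint (1 - P0) = 1 - P0 := by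
      rw [map_sub, hPa, ← star_eq_adjoint, star_one]
    have hRa := adjoint_rankOne' f0 f0
    have hs : ∀ (W A B : H →L[ℂ] H), IsHilbertSchmidt e W → IsHilbertSchmidt e (A * W * B) :=
      fun W A B hW => hs_mul_right e _ (hs_mul_left e _ hW)
    simp only [pairInner, PiMap]
    rw [hsR_symm e X]
    rw [hsR_comb e (hs _ _ _ hX) (hs _ _ _ hX) (hs_rankOne e _ _) (hs_rankOne e _ _)
      (hs _ _ _ hX) (hs _ _ _ hX) hY, hsR_comb e (hs _ _ _ hY) (hs _ _ _ hY)
      (hs_rankOne e _ _) (hs_rankOne e _ _) (hs _ _ _ hY) (hs _ _ _ hY) hX]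
    rw [hsR_sandwich e hQa hPa hX hY, hsR_sandwich e hPa hQa hX hY, hsR_sandwich e hRa hQa hX hY,
      hsR_sandwich e hQa hRa hX hY]
    simp only [hsR_rankOne]
    rw [hsR_symm e X, hsR_symm e X, hsR_symm e X, hsR_symm e X]
    have sw : ∀ x y : H, (⟪x, y⟫_ℂ).re = (⟪y, x⟫_ℂ).re := fun x y => by
      rw [← inner_conj_symm, Complex.conj_re]
    have k1 : ∀ h, (⟪f0, Y ((1 - P0) h)⟫_ℂ).re = (⟪h, (1 - P0) (Y f0)⟫_ℂ).re := fun h => by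
      rw [← hYi, sw, ← adjoint_inner_right, hQa]
    have k2 : ∀ h, (⟪f0, X ((1 - P0) h)⟫_ℂ).re = (⟪h, (1 - P0) (X f0)⟫_ℂ).re := fun h => by
      rw [← hXi, sw, ← adjoint_inner_right, hQa]
    have k3 : ∀ u v, ⟪(1 - P0) u, v⟫_ℂ = ⟪u, (1 - P0) v⟫_ℂ := fun u v => by
      rw [← adjoint_inner_right, hQa]
    rw [k1, k2]
    have k4 : ⟪f, f0⟫_ℂ = (starRingEnd ℂ) ⟪f0, f⟫_ℂ := (inner_conj_symm _ _).symm
    have k5 := sw g ((1 - P0) (X f0))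
    simp only [sub_apply P0, rankOne_app, inner_add_left, inner_add_right, inner_smul_left,
      inner_smul_right, ← Complex.coe_smul, inner_sub_left, inner_sub_right, hP, k3, k4,
      Complex.conj_ofReal, map_mul, Complex.conj_I, Complex.add_re, Complex.sub_re,
      Complex.mul_re, Complex.mul_im, Complex.neg_re, Complex.neg_im, Complex.I_re, Complex.I_im,
      Complex.ofReal_re, Complex.ofReal_im, Complex.conj_re, Complex.conj_im]
    simp only [k3] at k5
    rw [k5]
    ring
  · intro X f hX hXs
    exact Pi_range e P0 hP0sa hP0idem f0 hf0 hf0fix X f hX hXs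
  · intro Z _ hZ
    exact Pi_tangent P0 hP0sa hP0idem f0 hf0 hf0fix Z hZ
end
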